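/- Let (R,m,K) be a Cohen-Macaulay Noetherian local ring with maximal ideal m and residue field K = R/m, let π ∈ m be a nonzerodivisor, write R̄ = R/πR, and let M be an R-module. Suppose that for all j ≥ 0 both dim_K Ext^j_{R̄}(K, Ann_M(π)) and dim_K Ext^j_{R̄}(K, M/πM) are finite, where Ann_M(π) = {x ∈ M : πx = 0} and M/πM = M ⊗_R R̄. Then dim_K Ext^j_R(K, M) is finite for all j ≥ 0. -/

import Mathlib

/-!
STATEMENT 14: Let `(R,m,K)` be a Cohen-Macaulay Noetherian local ring, `π ∈ m` a
nonzerodivisor, `R̄ = R/πR`, and `M` an `R`-module.  Suppose that for all `j ≥ 0` both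
`dim_K Ext^j_{R̄}(K, Ann_M(π))` and `dim_K Ext^j_{R̄}(K, M/πM)` are finite, where
`Ann_M(π) = {x ∈ M : πx = 0}` and `M/πM = M ⊗_R R̄` are `R̄`-modules, and `K` is the
residue field `(R/πR)/(m/πR)` of `R̄` (identified with `R/m`).  Then
`dim_K Ext^j_R(K, M)` is finite for all `j ≥ 0`.  Finiteness of the `K`-dimension of
these `K`-vector spaces is expressed as finite generation over the respective base ring.
-/

universe u

open CategoryTheory IsLocalRing Pointwise

/-- A Noetherian local ring is Cohen-Macaulay if its depth equals its Krull dimension,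
equivalently (for a Noetherian local ring) if there is a regular sequence contained in the
maximal ideal whose length is the Krull dimension. -/
def IsCohenMacaulayLocalRing (R : Type u) [CommRing R] [IsLocalRing R] : Prop :=
  ∃ rs : List R, (∀ r ∈ rs, r ∈ maximalIdeal R) ∧
    RingTheory.Sequence.IsRegular R rs ∧ (rs.length : WithBot ℕ∞) = ringKrullDim R


theorem aux_finite_transfer {R B : Type u} [CommRing R] [CommRing B] [IsNoetherianRing B]
    (σ : R →+* B) (hσ : Function.Surjective σ) {W E E' : Type*} [AddCommGroup W] [Module R W]
    [AddCommGroup E] [Module R E] [AddCommGroup E'] [Module B E'] [Module.Finite B E']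
    (q : W →ₗ[R] E) (hq : Function.Surjective q) (t : W →ₛₗ[σ] E')
    (hk : ∀ w, t w = 0 → q w = 0) : Module.Finite R E := by
  have : RingHomSurjective σ := ⟨hσ⟩
  let e : LinearMap.range t ≃ₗ[B] LinearMap.range t := LinearEquiv.refl _ _
  have hfin : Module.Finite B (LinearMap.range t) := inferInstance
  obtain ⟨s, hs⟩ := hfin.fg_top
  choose f hf using fun x : LinearMap.range t => x.2
  classical
  refine ⟨⟨s.image (fun x => q (f x)), ?_⟩⟩
  rw [eq_top_iff]
  rintro x -
  obtain ⟨w, rfl⟩ := hq x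
  have key : ∀ y ∈ Submodule.span B (s : Set (LinearMap.range t)), ∀ w, t w = y.1 →
      q w ∈ Submodule.span R ((s.image (fun x => q (f x)) : Finset E) : Set E) := by
    intro y hy
    induction hy using Submodule.span_induction with
    | mem x hx =>
      intro w hw
      have : q w = q (f x) := by
        rw [← sub_eq_zero, ← map_sub]; apply hk; rw [map_sub, hw, hf, sub_self]
      rw [this]
      exact Submodule.subset_span (by simpa using ⟨x.1, x.2, by simpa using hx, rfl⟩)
    | zero => intro w hw; rw [hk w (by simpa using hw)]; exact zero_mem _
    | add x y _ _ hx hy =>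
      intro w hw
      have : q w = q (f x) + q (f y) := by
        rw [← sub_eq_zero, ← map_add, ← map_sub]; apply hk
        rw [map_sub, hw, map_add, hf, hf]; simp
      rw [this]
      exact add_mem (hx _ (hf _)) (hy _ (hf _))
    | smul b x _ hx =>
      intro w hw
      obtain ⟨r, rfl⟩ := hσ b
      have : q w = r • q (f x) := by
        rw [← sub_eq_zero, ← map_smul, ← map_sub]; apply hk
        rw [map_sub, hw, map_smulₛₗ, hf]; simp
      rw [this]
      exact Submodule.smul_mem _ _ (hx _ (hf _))
  exact key ⟨t w, w, rfl⟩ (hs ▸ trivial) w rfl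

section compare
variable {A : Type u} [CommRing A] {X Y : ModuleCat.{u} A} (P : ProjectiveResolution X)

theorem aux_smul_extMk {n : ℕ} (r : A) (f : P.complex.X n ⟶ Y) (m : ℕ) (hm : n + 1 = m)
    (hf : P.complex.d m n ≫ f = 0) :
    r • P.extMk f m hm hf = P.extMk (r • f) m hm (by simp [hf]) := by
  rw [Abelian.Ext.smul_eq_comp_mk₀, P.extMk_comp_mk₀]
  simp

theorem aux_extMk_zero (f : P.complex.X 0 ⟶ Y) (hf : P.complex.d 1 0 ≫ f = 0)
    (h : P.extMk f 1 rfl hf = 0) : f = 0 := by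
  simp only [← P.extEquivCohomologyClass.apply_eq_iff_eq,
    ProjectiveResolution.extEquivCohomologyClass_extMk, ProjectiveResolution.extEquivCohomologyClass_zero,
    CochainComplex.HomComplex.CohomologyClass.mk_eq_zero_iff] at h
  rw [CochainComplex.HomComplex.Cocycle.toSingleMk_mem_coboundaries_iff _ _ _ _ _ 1 (by simp)] at h
  obtain ⟨g, hg⟩ := h
  have : g = 0 := by
    apply Limits.IsZero.eq_of_src
    exact P.cochainComplex.isZero_of_isStrictlyLE 0 1
  rw [this, Limits.comp_zero] at hg
  rw [← cancel_epi (P.cochainComplexXIso (-(0:ℕ)) 0 rfl).hom, ← hg]; simp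

/-- cocycles -/
def auxZ (P : ProjectiveResolution X) (Y : ModuleCat.{u} A) (n : ℕ) :
    Submodule A (P.complex.X n ⟶ Y) :=
  LinearMap.ker (Linear.leftComp A Y (P.complex.d (n+1) n))

noncomputable def auxNew (n : ℕ) : auxZ P Y n →ₗ[A] Abelian.Ext X Y n where
  toFun f := P.extMk f.1 (n+1) rfl f.2
  map_add' _ _ := (P.add_extMk _ _ _ _ _ _).symm
  map_smul' _ _ := (aux_smul_extMk P _ _ _ _ _).symm

theorem auxNew_surj (n : ℕ) : Function.Surjective (auxNew P (Y := Y) n) := by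
  intro x
  obtain ⟨f, hf, h⟩ := P.extMk_surjective x (n+1) rfl
  exact ⟨⟨f, hf⟩, h⟩

/-- The map from cocycles to the categorical cycles. -/
noncomputable def auxLift (n : ℕ) :
    ModuleCat.of A (auxZ P Y n) ⟶ (P.complex.linearYonedaObj A Y).cycles n :=
  (P.complex.linearYonedaObj A Y).liftCycles (A := ModuleCat.of A (auxZ P Y n)) (i := n)
    (ModuleCat.ofHom (auxZ P Y n).subtype) (n+1) (by simp) (by
      ext f; exact f.2)

theorem auxLift_i (n : ℕ) (f : auxZ P Y n) :
    (P.complex.linearYonedaObj A Y).iCycles n (auxLift P n f) = f.1 := by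
  have := (P.complex.linearYonedaObj A Y).liftCycles_i (A := ModuleCat.of A (auxZ P Y n)) (i := n)
    (ModuleCat.ofHom (auxZ P Y n).subtype) (n+1) (by simp) (by
      ext f; exact f.2)
  exact congr($this f)

/-- The map from cocycles to the homology of the Hom complex. -/
noncomputable def auxOld (n : ℕ) :
    auxZ P Y n →ₗ[A] (P.complex.linearYonedaObj A Y).homology n :=
  (auxLift P n ≫ (P.complex.linearYonedaObj A Y).homologyπ n).hom

theorem auxOld_i (n : ℕ) (f : auxZ P Y n) (z : (P.complex.linearYonedaObj A Y).cycles n)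
    (h : (P.complex.linearYonedaObj A Y).iCycles n z = f.1) :
    auxOld P n f = (P.complex.linearYonedaObj A Y).homologyπ n z := by
  have : auxLift P n f = z :=
    (ModuleCat.mono_iff_injective ((P.complex.linearYonedaObj A Y).iCycles n)).1 inferInstance
      ((auxLift_i P n f).trans h.symm)
  rw [← this]
  rfl

theorem auxOld_surj (n : ℕ) : Function.Surjective (auxOld P (Y := Y) n) := by
  intro x
  obtain ⟨z, rfl⟩ := (ModuleCat.epi_iff_surjective
    ((P.complex.linearYonedaObj A Y).homologyπ n)).1 inferInstance x
  refine ⟨⟨(P.complex.linearYonedaObj A Y).iCycles n z, ?_⟩, auxOld_i P n _ z rfl⟩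
  have := (P.complex.linearYonedaObj A Y).iCycles_d n (n+1)
  exact congr($this z)

theorem auxOld_exact (n i : ℕ) (hi : (ComplexShape.up ℕ).prev n = i) (f : auxZ P Y n) :
    auxOld P n f = 0 ↔ ∃ g : P.complex.X i ⟶ Y, P.complex.d n i ≫ g = f.1 := by
  have hex := ShortComplex.exact_of_g_is_cokernel
    (ShortComplex.mk _ _ ((P.complex.linearYonedaObj A Y).toCycles_comp_homologyπ i n))
    ((P.complex.linearYonedaObj A Y).homologyIsCokernel i n hi)
  rw [ShortComplex.moduleCat_exact_iff] at hex
  have hti := (P.complex.linearYonedaObj A Y).toCycles_i i n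
  constructor
  · intro h
    obtain ⟨g, hg⟩ := hex (auxLift P n f) h
    refine ⟨g, ?_⟩
    exact (congr($hti g)).symm.trans
      ((congr((P.complex.linearYonedaObj A Y).iCycles n $hg)).trans (auxLift_i P n f))
  · rintro ⟨g, hg⟩
    have h0 := (P.complex.linearYonedaObj A Y).toCycles_comp_homologyπ i n
    exact (auxOld_i P n f ((P.complex.linearYonedaObj A Y).toCycles i n g)
      ((congr($hti g)).trans hg)).trans (congr($h0 g))

theorem aux_ker (n : ℕ) : LinearMap.ker (auxOld P (Y := Y) n) = LinearMap.ker (auxNew P n) := by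
  ext f
  rw [LinearMap.mem_ker, LinearMap.mem_ker]
  cases n with
  | zero =>
    rw [auxOld_exact P 0 0 (by simp)]
    constructor
    · rintro ⟨g, hg⟩
      have : f = 0 := by ext1; rw [← hg]; simp
      rw [this, map_zero]
    · intro h
      refine ⟨0, ?_⟩
      rw [aux_extMk_zero P f.1 f.2 h]; simp
  | succ p =>
    rw [auxOld_exact P (p+1) p (by simp)]
    exact (P.extMk_eq_zero_iff f.1 _ rfl f.2 p rfl).symm

end compare

theorem aux_compare {A : Type u} [CommRing A] (X Y : ModuleCat.{u} A) (n : ℕ) :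
    Nonempty ((((Ext A (ModuleCat.{u} A) n).obj (Opposite.op X)).obj Y) ≃ₗ[A]
      Abelian.Ext X Y n) := by
  let P := projectiveResolution X
  exact ⟨(P.isoExt n Y).toLinearEquiv ≪≫ₗ
    ((auxOld P n).quotKerEquivOfSurjective (auxOld_surj P n)).symm ≪≫ₗ
    Submodule.quotEquivOfEq _ _ (aux_ker P n) ≪≫ₗ
    (auxNew P n).quotKerEquivOfSurjective (auxNew_surj P n)⟩


section ses
variable {A : Type u} [CommRing A] {Y F X : Type u} [AddCommGroup Y] [Module A Y]
  [AddCommGroup F] [Module A F] [AddCommGroup X] [Module A X]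
  {i : Y →ₗ[A] F} {g : F →ₗ[A] X} (hi : Function.Injective i) (hg : Function.Surjective g)
  (hig : Function.Exact i g) (N : Type u) [AddCommGroup N] [Module A N]

include hi hg hig

theorem aux_ses : (ModuleCat.shortComplexOfCompEqZero i g hig.linearMap_comp_eq_zero).ShortExact :=
  ModuleCat.shortComplex_shortExact _ hig hi hg

theorem aux_delta_one : ∃ δ : (Y →ₗ[A] N) →ₗ[A] Abelian.Ext (ModuleCat.of A X) (ModuleCat.of A N) 1,
    (Module.Projective A F → Function.Surjective δ) ∧
    ∀ φ, δ φ = 0 ↔ ∃ h : F →ₗ[A] N, h ∘ₗ i = φ := by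
  have hS := aux_ses hi hg hig
  let e : (Y →ₗ[A] N) ≃ₗ[A] Abelian.Ext (ModuleCat.of A Y) (ModuleCat.of A N) 0 :=
    (Abelian.Ext.linearEquiv₀.trans ModuleCat.homLinearEquiv).symm
  have he : ∀ φ, e φ = Abelian.Ext.mk₀ (ModuleCat.ofHom φ) := fun φ => rfl
  refine ⟨(hS.extClass.precompOfLinear A (ModuleCat.of A N) (add_zero 1)) ∘ₗ e.toLinearMap, ?_, ?_⟩
  · intro hF
    have : Projective (ModuleCat.shortComplexOfCompEqZero i g hig.linearMap_comp_eq_zero).X₂ :=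
      (IsProjective.iff_projective F).1 hF
    exact (precomp_extClass_surjective_of_projective_X₂ _ hS 0).comp e.surjective
  · intro φ
    constructor
    · intro h
      obtain ⟨x, hx⟩ := Abelian.Ext.contravariant_sequence_exact₁ hS (ModuleCat.of A N) (e φ)
        (add_zero 1) h
      obtain ⟨f, rfl⟩ := (Abelian.Ext.linearEquiv₀ (R := A)).symm.surjective x
      refine ⟨f.hom, ?_⟩
      rw [he, Abelian.Ext.linearEquiv₀_symm_apply, Abelian.Ext.mk₀_comp_mk₀] at hx
      have := (Abelian.Ext.linearEquiv₀ (R := A)).symm.injective hx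
      exact congr(($this).hom)
    · rintro ⟨h, rfl⟩
      have : e (h ∘ₗ i) = (Abelian.Ext.mk₀ (ModuleCat.ofHom i)).comp
          (Abelian.Ext.mk₀ (ModuleCat.ofHom h)) (zero_add 0) := by
        rw [he, Abelian.Ext.mk₀_comp_mk₀]; rfl
      change hS.extClass.comp (e (h ∘ₗ i)) (add_zero 1) = 0
      rw [this]
      exact hS.extClass_comp_assoc _

theorem aux_delta [Module.Projective A F] (n : ℕ) :
    ∃ δ : Abelian.Ext (ModuleCat.of A Y) (ModuleCat.of A N) n →ₗ[A]
      Abelian.Ext (ModuleCat.of A X) (ModuleCat.of A N) (n+1),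
    Function.Surjective δ ∧ (n ≠ 0 → Function.Injective δ) := by
  have hS := aux_ses hi hg hig
  have : Projective (ModuleCat.shortComplexOfCompEqZero i g hig.linearMap_comp_eq_zero).X₂ :=
      (IsProjective.iff_projective F).1 inferInstance
  refine ⟨hS.extClass.precompOfLinear A (ModuleCat.of A N) (add_comm 1 n),
    precomp_extClass_surjective_of_projective_X₂ _ hS n, ?_⟩
  intro hn
  rw [injective_iff_map_eq_zero]
  intro x hx
  obtain ⟨y, hy⟩ := Abelian.Ext.contravariant_sequence_exact₁ hS (ModuleCat.of A N) x
    (add_comm 1 n) hx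
  obtain ⟨k, rfl⟩ := Nat.exists_eq_succ_of_ne_zero hn
  rw [← hy, Abelian.Ext.eq_zero_of_projective y, Abelian.Ext.comp_zero]

theorem aux_mid [IsNoetherianRing A] (n : ℕ)
    (h1 : Module.Finite A (Abelian.Ext (ModuleCat.of A X) (ModuleCat.of A N) n))
    (h2 : Module.Finite A (Abelian.Ext (ModuleCat.of A Y) (ModuleCat.of A N) n)) :
    Module.Finite A (Abelian.Ext (ModuleCat.of A F) (ModuleCat.of A N) n) := by
  have hS := aux_ses hi hg hig
  let a := (Abelian.Ext.mk₀ (ModuleCat.ofHom g)).precompOfLinear A (ModuleCat.of A N) (zero_add n)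
  let b := (Abelian.Ext.mk₀ (ModuleCat.ofHom i)).precompOfLinear A (ModuleCat.of A N) (zero_add n)
  have : IsNoetherian A (Abelian.Ext (ModuleCat.of A X) (ModuleCat.of A N) n) := inferInstance
  have : IsNoetherian A (Abelian.Ext (ModuleCat.of A Y) (ModuleCat.of A N) n) := inferInstance
  have hab : Function.Exact a b := by
    intro y
    constructor
    · intro h
      exact Abelian.Ext.contravariant_sequence_exact₂ hS (ModuleCat.of A N) y h
    · rintro ⟨x, rfl⟩
      change (Abelian.Ext.mk₀ (ModuleCat.ofHom i)).comp ((Abelian.Ext.mk₀ (ModuleCat.ofHom g)).comp x (zero_add n)) (zero_add n) = 0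
      rw [Abelian.Ext.mk₀_comp_mk₀_assoc]
      have : ModuleCat.ofHom i ≫ ModuleCat.ofHom g = 0 := by
        ext x; exact hig.apply_apply_eq_zero x
      rw [this]; simp
  have := isNoetherian_of_range_eq_ker a b (LinearMap.exact_iff.1 hab).symm
  infer_instance

/-- covariant version: kernel of `Ext(Z,F) → Ext(Z,X)` etc. -/
theorem aux_cov_mid (Z : ModuleCat.{u} A) (n : ℕ) (x : Abelian.Ext Z (ModuleCat.of A F) n)
    (hx : x.comp (Abelian.Ext.mk₀ (ModuleCat.ofHom g)) (add_zero n) = 0) :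
    ∃ y : Abelian.Ext Z (ModuleCat.of A Y) n,
      y.comp (Abelian.Ext.mk₀ (ModuleCat.ofHom i)) (add_zero n) = x :=
  Abelian.Ext.covariant_sequence_exact₂ Z (aux_ses hi hg hig) x hx

theorem aux_cov_left (Z : ModuleCat.{u} A) (n : ℕ) : 
    ∃ δ : Abelian.Ext Z (ModuleCat.of A X) n →ₗ[A] Abelian.Ext Z (ModuleCat.of A Y) (n+1),
    ∀ x : Abelian.Ext Z (ModuleCat.of A Y) (n+1), 
    x.comp (Abelian.Ext.mk₀ (ModuleCat.ofHom i)) (add_zero _) = 0 → ∃ y, δ y = x := by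
  have hS := aux_ses hi hg hig
  refine ⟨hS.extClass.postcompOfLinear A Z rfl, fun x hx => ?_⟩
  exact Abelian.Ext.covariant_sequence_exact₁ Z hS x hx rfl

end ses


section base
variable {R B : Type u} [CommRing R] [CommRing B] [Algebra R B] {π : R}
  (hsurj : Function.Surjective (algebraMap R B))
  (hB : ∀ r, algebraMap R B r = 0 ↔ ∃ s, r = π * s)
  {N : Type u} [AddCommGroup N] [Module R N] [Module B N] [IsScalarTower R B N]

include hB in
theorem aux_pi_smul (n : N) : π • n = 0 := by
  rw [← algebraMap_smul B π n, (hB π).2 ⟨1, by simp⟩, zero_smul]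

include hsurj hB in
theorem aux_descend {X Xb : Type u} [AddCommGroup X] [Module R X] [AddCommGroup Xb] [Module B Xb]
    (p : X →ₛₗ[algebraMap R B] Xb) (hp : Function.Surjective p)
    (hk : ∀ x, p x = 0 → ∃ y, x = π • y) :
    ∃ D : (X →ₗ[R] N) →ₛₗ[algebraMap R B] (Xb →ₗ[B] N), ∀ φ x, D φ (p x) = φ x := by
  choose s hs using hp
  have key : ∀ (φ : X →ₗ[R] N) x, φ (s (p x)) = φ x := by
    intro φ x
    obtain ⟨y, hy⟩ := hk (s (p x) - x) (by rw [map_sub, hs, sub_self])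
    rw [← sub_eq_zero, ← map_sub, hy, map_smul, aux_pi_smul hB]
  have hs2 : ∀ b, ∃ x, b = p x := fun b => ⟨s b, (hs b).symm⟩
  refine ⟨{ toFun := fun φ => { toFun := fun b => φ (s b), map_add' := ?_, map_smul' := ?_ },
            map_add' := ?_, map_smul' := ?_ }, key⟩
  · intro x y
    obtain ⟨x, rfl⟩ := hs2 x
    obtain ⟨y, rfl⟩ := hs2 y
    rw [← map_add, key, key, key, map_add]
  · intro b y
    obtain ⟨b, rfl⟩ := hsurj b
    obtain ⟨y, rfl⟩ := hs2 y
    rw [← map_smulₛₗ, key, key, map_smul, RingHom.id_apply, algebraMap_smul]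
  · intro φ ψ; ext; simp
  · intro r φ; ext; simp

include hsurj hB in
theorem aux_claimA [IsNoetherianRing B] (j : ℕ) : ∀ {X Xb : Type u} [AddCommGroup X] [Module R X]
    [AddCommGroup Xb] [Module B Xb]
    (p : X →ₛₗ[algebraMap R B] Xb) (_ : Function.Surjective p)
    (_ : ∀ x, p x = 0 → ∃ y, x = π • y) (_ : ∀ x : X, π • x = 0 → x = 0)
    (_ : ∀ r : R, π * r = 0 → r = 0)
    (_ : Module.Finite B (Abelian.Ext (ModuleCat.of B Xb) (ModuleCat.of B N) j)),
    Module.Finite R (Abelian.Ext (ModuleCat.of R X) (ModuleCat.of R N) j) := by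
  have hsj : RingHomSurjective (algebraMap R B) := ⟨hsurj⟩
  induction j with
  | zero =>
    intro X Xb _ _ _ _ p hp hk hreg hnzd hfin
    obtain ⟨D, hD⟩ := aux_descend (N := N) hsurj hB p hp hk
    let e : (X →ₗ[R] N) ≃ₗ[R] Abelian.Ext (ModuleCat.of R X) (ModuleCat.of R N) 0 :=
      (Abelian.Ext.linearEquiv₀.trans ModuleCat.homLinearEquiv).symm
    let e' : (Xb →ₗ[B] N) ≃ₗ[B] Abelian.Ext (ModuleCat.of B Xb) (ModuleCat.of B N) 0 :=
      (Abelian.Ext.linearEquiv₀.trans ModuleCat.homLinearEquiv).symm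
    refine aux_finite_transfer (algebraMap R B) hsurj e.toLinearMap e.surjective
      (e'.toLinearMap.comp D) ?_
    intro φ h
    have h' : D φ = 0 := e'.injective (by rw [map_zero]; exact h)
    have : φ = 0 := by ext x; rw [← hD, h']; rfl
    rw [this, map_zero]
  | succ n ih =>
    intro X Xb _ _ _ _ p hp hk hreg hnzd hfin
    let g : (X →₀ R) →ₗ[R] X := Finsupp.linearCombination R id
    let gb : (X →₀ B) →ₗ[B] Xb := Finsupp.linearCombination B p
    have hg : Function.Surjective g := Finsupp.linearCombination_id_surjective R X
    let P : (X →₀ R) →ₛₗ[algebraMap R B] (X →₀ B) := 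
      Finsupp.mapRange.linearMap ((algebraMap R B).toSemilinearMap)
    have hPg : ∀ f, gb (P f) = p (g f) := by
      intro f
      induction f using Finsupp.induction_linear with
      | zero => simp
      | add f g hf hg => rw [map_add, map_add, hf, hg, map_add, map_add]
      | single x r => simp [g, gb, P]
    have hPs : Function.Surjective P := Finsupp.mapRange_surjective _ (map_zero _) hsurj
    have hPk : ∀ f, P f = 0 → ∃ f', f = π • f' := by
      intro f hf
      have : ∀ r : R, ∃ c, (r = 0 → c = 0) ∧ (algebraMap R B r = 0 → r = π * c) := by
        intro r
        by_cases hr : r = 0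
        · exact ⟨0, by simp [hr]⟩
        by_cases hr' : algebraMap R B r = 0
        · obtain ⟨c, hc⟩ := (hB r).1 hr'
          exact ⟨c, fun h => absurd h hr, fun _ => hc⟩
        · exact ⟨0, by simp [hr']⟩
      choose c hc0 hc using this
      refine ⟨f.mapRange c (hc0 0 rfl), ?_⟩
      ext x
      have := DFunLike.congr_fun hf x
      simpa using hc _ (by simpa [P] using this)
    have hgb : Function.Surjective gb := by
      intro b
      obtain ⟨x, rfl⟩ := hp b
      obtain ⟨f, rfl⟩ := hg x
      exact ⟨_, hPg f⟩
    let pker : LinearMap.ker g →ₛₗ[algebraMap R B] LinearMap.ker gb :=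
      { toFun := fun y => ⟨P y.1, by rw [LinearMap.mem_ker, hPg, y.2, map_zero]⟩
        map_add' := fun x y => by ext1; simp
        map_smul' := fun x y => by ext1; simp }
    have hps2 : Function.Surjective pker := by
      rintro ⟨b, hb⟩
      obtain ⟨f, rfl⟩ := hPs b
      obtain ⟨y, hy⟩ := hk (g f) (by rw [← hPg]; exact hb)
      obtain ⟨f', rfl⟩ := hg y
      refine ⟨⟨f - π • f', by rw [LinearMap.mem_ker, map_sub, map_smul, hy, sub_self]⟩, ?_⟩
      ext1
      change P (f - π • f') = P f
      rw [map_sub, map_smulₛₗ, (hB π).2 ⟨1, by simp⟩, zero_smul, sub_zero]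
    have hpk2 : ∀ x, pker x = 0 → ∃ y, x = π • y := by
      rintro ⟨f, hf⟩ h
      obtain ⟨f', rfl⟩ := hPk f congr(($h).1)
      refine ⟨⟨f', hreg _ ?_⟩, rfl⟩
      rw [← map_smul]; exact hf
    have hreg' : ∀ x : LinearMap.ker g, π • x = 0 → x = 0 := by
      rintro ⟨f, hf⟩ h
      ext x
      have := DFunLike.congr_fun congr(($h).1) x
      exact hnzd _ (by simpa using this)
    have hex : Function.Exact (LinearMap.ker g).subtype g := LinearMap.exact_subtype_ker_map g
    have hexb : Function.Exact (LinearMap.ker gb).subtype gb := LinearMap.exact_subtype_ker_map gb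
    rcases Nat.eq_zero_or_pos n with rfl | hn
    · obtain ⟨δ, hδs, hδ⟩ := aux_delta_one (Submodule.subtype_injective _) hg hex N
      obtain ⟨δb, -, hδb⟩ := aux_delta_one (Submodule.subtype_injective _) hgb hexb N
      obtain ⟨D, hD⟩ := aux_descend (N := N) (X := LinearMap.ker g) (Xb := LinearMap.ker gb) hsurj hB pker hps2 hpk2
      refine aux_finite_transfer (algebraMap R B) hsurj δ (hδs inferInstance) (δb.comp D) ?_
      intro φ h
      obtain ⟨ψ, hψ⟩ := (hδb _).1 h
      rw [hδ]
      refine ⟨{ toFun := fun f => ψ (P f), map_add' := ?_, map_smul' := ?_ }, ?_⟩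
      · intro x y; simp
      · intro r x; simp
      · ext y
        rw [← hD φ, ← hψ]; rfl
    · obtain ⟨δ, hδs, hδ⟩ := aux_delta (Submodule.subtype_injective _) hg hex N n
      obtain ⟨δb, hδbs, hδb⟩ := aux_delta (Submodule.subtype_injective _) hgb hexb N n
      have : IsNoetherian B (Abelian.Ext (ModuleCat.of B Xb) (ModuleCat.of B N) (n+1)) :=
        inferInstance
      have := ih (X := LinearMap.ker g) (Xb := LinearMap.ker gb) pker hps2 hpk2 hreg' hnzd (Module.Finite.of_injective δb (hδb hn.ne'))
      exact Module.Finite.of_surjective δ hδs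

end base


theorem aux_descendW {R B : Type u} [CommRing R] [CommRing B] [Algebra R B]
    (hsurj : Function.Surjective (algebraMap R B))
    {N : Type u} [AddCommGroup N] [Module R N] [Module B N] [IsScalarTower R B N]
    {X Xb : Type u} [AddCommGroup X] [Module R X] [AddCommGroup Xb] [Module B Xb]
    (p : X →ₛₗ[algebraMap R B] Xb) (hp : Function.Surjective p)
    (W : Submodule R (X →ₗ[R] N)) (hW : ∀ φ ∈ W, ∀ x, p x = 0 → φ x = 0) :
    ∃ D : W →ₛₗ[algebraMap R B] (Xb →ₗ[B] N), ∀ (φ : W) x, D φ (p x) = φ.1 x := by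
  choose s hs using hp
  have key : ∀ (φ : W) x, φ.1 (s (p x)) = φ.1 x := by
    intro φ x
    rw [← sub_eq_zero, ← map_sub]
    exact hW φ.1 φ.2 _ (by rw [map_sub, hs, sub_self])
  have hs2 : ∀ b, ∃ x, b = p x := fun b => ⟨s b, (hs b).symm⟩
  refine ⟨{ toFun := fun φ => { toFun := fun b => φ.1 (s b), map_add' := ?_, map_smul' := ?_ },
            map_add' := ?_, map_smul' := ?_ }, key⟩
  · intro x y
    obtain ⟨x, rfl⟩ := hs2 x
    obtain ⟨y, rfl⟩ := hs2 y
    rw [← map_add, key, key, key, map_add]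
  · intro b y
    obtain ⟨b, rfl⟩ := hsurj b
    obtain ⟨y, rfl⟩ := hs2 y
    rw [← map_smulₛₗ, key, key, map_smul, RingHom.id_apply, algebraMap_smul]
  · intro φ ψ; ext; simp
  · intro r φ; ext; simp

section main
set_option linter.unusedSectionVars false
variable {R : Type u} [CommRing R] [IsNoetherianRing R] (m : Ideal R) {π : R} (hm : π ∈ m)
  (hnzd : ∀ r : R, π * r = 0 → r = 0)
  (N : Type u) [AddCommGroup N] [Module R N] [Module (R ⧸ Ideal.span {π}) N]
  [IsScalarTower R (R ⧸ Ideal.span {π}) N]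


theorem aux_hsurj : Function.Surjective (algebraMap R (R ⧸ Ideal.span {π})) := Ideal.Quotient.mk_surjective

theorem aux_hB (r : R) : algebraMap R (R ⧸ Ideal.span {π}) r = 0 ↔ ∃ s, r = π * s := by
  rw [Ideal.Quotient.algebraMap_eq, Ideal.Quotient.eq_zero_iff_mem, Ideal.mem_span_singleton]
  rfl

/-- m → m̄ -/
def auxP : m →ₛₗ[algebraMap R (R ⧸ Ideal.span {π})] (Ideal.map (Ideal.Quotient.mk (Ideal.span {π})) m) where
  toFun x := ⟨algebraMap R (R ⧸ Ideal.span {π}) x.1, Ideal.mem_map_of_mem _ x.2⟩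
  map_add' x y := by ext1; simp
  map_smul' r x := by ext1; simp

theorem auxP_surj : Function.Surjective (auxP (π := π) m) := by
  rintro ⟨b, hb⟩
  obtain ⟨x, hx, rfl⟩ := (Ideal.mem_map_iff_of_surjective _ Ideal.Quotient.mk_surjective).1 hb
  exact ⟨⟨x, hx⟩, rfl⟩

/-- R → K -/
def auxG : R →ₗ[R] ((R ⧸ Ideal.span {π}) ⧸ (Ideal.map (Ideal.Quotient.mk (Ideal.span {π})) m)) := Algebra.linearMap R ((R ⧸ Ideal.span {π}) ⧸ (Ideal.map (Ideal.Quotient.mk (Ideal.span {π})) m))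

theorem auxG_surj : Function.Surjective (auxG (π := π) m) := by
  intro x
  obtain ⟨x, rfl⟩ := Ideal.Quotient.mk_surjective x
  obtain ⟨x, rfl⟩ := Ideal.Quotient.mk_surjective x
  exact ⟨x, rfl⟩

include hm in
theorem auxG_exact : Function.Exact m.subtype (auxG (π := π) m) := by
  intro x
  have : auxG (π := π) m x = Ideal.Quotient.mk (Ideal.map (Ideal.Quotient.mk (Ideal.span {π})) m) (Ideal.Quotient.mk _ x) := rfl
  rw [this, Ideal.Quotient.eq_zero_iff_mem, ← Ideal.mem_comap,
    Ideal.comap_map_of_surjective _ Ideal.Quotient.mk_surjective]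
  have h2 : m ⊔ Ideal.comap (Ideal.Quotient.mk (Ideal.span {π})) ⊥ = m := by
    rw [← RingHom.ker_eq_comap_bot, Ideal.mk_ker, sup_eq_left, Ideal.span_singleton_le_iff_mem]
    exact hm
  rw [h2]
  simp

theorem auxGb_exact : Function.Exact (Submodule.subtype (Ideal.map (Ideal.Quotient.mk (Ideal.span {π})) m)) (Submodule.mkQ (Ideal.map (Ideal.Quotient.mk (Ideal.span {π})) m)) := by
  intro x; simpa using Ideal.Quotient.eq_zero_iff_mem

theorem aux_K_zero 
    (h : Module.Finite (R ⧸ Ideal.span {π}) (Abelian.Ext (ModuleCat.of (R ⧸ Ideal.span {π}) ((R ⧸ Ideal.span {π}) ⧸ (Ideal.map (Ideal.Quotient.mk (Ideal.span {π})) m))) (ModuleCat.of (R ⧸ Ideal.span {π}) N) 0)) :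
    Module.Finite R (Abelian.Ext (ModuleCat.of R ((R ⧸ Ideal.span {π}) ⧸ (Ideal.map (Ideal.Quotient.mk (Ideal.span {π})) m))) (ModuleCat.of R N) 0) := by
  let p : ((R ⧸ Ideal.span {π}) ⧸ (Ideal.map (Ideal.Quotient.mk (Ideal.span {π})) m)) →ₛₗ[algebraMap R (R ⧸ Ideal.span {π})] ((R ⧸ Ideal.span {π}) ⧸ (Ideal.map (Ideal.Quotient.mk (Ideal.span {π})) m)) :=
    { toFun := id, map_add' := fun _ _ => rfl, map_smul' := fun r x => (algebraMap_smul (R ⧸ Ideal.span {π}) r x).symm }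
  obtain ⟨D, hD⟩ := aux_descend (N := N) aux_hsurj aux_hB p Function.surjective_id
    (fun x hx => ⟨0, by rw [smul_zero]; exact hx⟩)
  let e : (((R ⧸ Ideal.span {π}) ⧸ (Ideal.map (Ideal.Quotient.mk (Ideal.span {π})) m)) →ₗ[R] N) ≃ₗ[R] Abelian.Ext (ModuleCat.of R ((R ⧸ Ideal.span {π}) ⧸ (Ideal.map (Ideal.Quotient.mk (Ideal.span {π})) m))) (ModuleCat.of R N) 0 :=
    (Abelian.Ext.linearEquiv₀.trans ModuleCat.homLinearEquiv).symm
  let e' : (((R ⧸ Ideal.span {π}) ⧸ (Ideal.map (Ideal.Quotient.mk (Ideal.span {π})) m)) →ₗ[(R ⧸ Ideal.span {π})] N) ≃ₗ[(R ⧸ Ideal.span {π})] Abelian.Ext (ModuleCat.of (R ⧸ Ideal.span {π}) ((R ⧸ Ideal.span {π}) ⧸ (Ideal.map (Ideal.Quotient.mk (Ideal.span {π})) m))) (ModuleCat.of (R ⧸ Ideal.span {π}) N) 0 :=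
    (Abelian.Ext.linearEquiv₀.trans ModuleCat.homLinearEquiv).symm
  refine aux_finite_transfer (algebraMap R (R ⧸ Ideal.span {π})) aux_hsurj e.toLinearMap e.surjective
    (e'.toLinearMap.comp D) ?_
  intro φ h
  have h' : D φ = 0 := e'.injective (by rw [map_zero]; exact h)
  have : φ = 0 := by
    apply LinearMap.ext
    intro x
    rw [← hD, h']; rfl
  rw [this, map_zero]

include hm in
theorem aux_K_one
    (h0 : Module.Finite R (Abelian.Ext (ModuleCat.of R ((R ⧸ Ideal.span {π}) ⧸ (Ideal.map (Ideal.Quotient.mk (Ideal.span {π})) m))) (ModuleCat.of R N) 0))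
    (h : Module.Finite (R ⧸ Ideal.span {π}) (Abelian.Ext (ModuleCat.of (R ⧸ Ideal.span {π}) ((R ⧸ Ideal.span {π}) ⧸ (Ideal.map (Ideal.Quotient.mk (Ideal.span {π})) m))) (ModuleCat.of (R ⧸ Ideal.span {π}) N) 1)) :
    Module.Finite R (Abelian.Ext (ModuleCat.of R ((R ⧸ Ideal.span {π}) ⧸ (Ideal.map (Ideal.Quotient.mk (Ideal.span {π})) m))) (ModuleCat.of R N) 1) := by
  obtain ⟨δ, hδs, hδ⟩ := aux_delta_one (Submodule.subtype_injective m) (auxG_surj (π := π) m)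
    (auxG_exact m hm) N
  obtain ⟨δb, -, hδb⟩ := aux_delta_one (Submodule.subtype_injective (Ideal.map (Ideal.Quotient.mk (Ideal.span {π})) m)) (Submodule.mkQ_surjective (Ideal.map (Ideal.Quotient.mk (Ideal.span {π})) m))
    (auxGb_exact m) N
  let ev : (m →ₗ[R] N) →ₗ[R] N := LinearMap.applyₗ ⟨π, hm⟩
  let W0 := LinearMap.ker ev
  have hW0 : ∀ φ ∈ W0, ∀ x, auxP (π := π) m x = 0 → φ x = 0 := by
    rintro φ hφ ⟨x, hx⟩ h
    obtain ⟨s, rfl⟩ := (aux_hB (π := π) x).1 congr(($h).1)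
    have : (⟨π * s, hx⟩ : m) = s • ⟨π, hm⟩ := by ext; simp [mul_comm]
    rw [this, map_smul]
    have h3 : φ ⟨π, hm⟩ = 0 := hφ
    rw [h3, smul_zero]
  obtain ⟨D, hD⟩ := aux_descendW (N := N) aux_hsurj (auxP (π := π) m) (auxP_surj m) W0 hW0
  let E0 := LinearMap.range (δ ∘ₗ W0.subtype)
  have hE0 : Module.Finite R E0 := by
    refine aux_finite_transfer (algebraMap R (R ⧸ Ideal.span {π})) aux_hsurj (δ ∘ₗ W0.subtype).rangeRestrict
      (LinearMap.surjective_rangeRestrict _) (δb.comp D) ?_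
    intro φ h
    obtain ⟨ψ, hψ⟩ := (hδb _).1 h
    ext1
    change δ φ.1 = 0
    rw [hδ]
    refine ⟨{ toFun := fun r => ψ (algebraMap R (R ⧸ Ideal.span {π}) r), map_add' := ?_, map_smul' := ?_ }, ?_⟩
    · intro x y; rw [map_add, map_add]
    · intro r x; rw [smul_eq_mul, map_mul, ← smul_eq_mul, map_smul, algebraMap_smul]; rfl
    · ext y
      rw [← hD φ, ← hψ]; rfl
  let ev1 : (((R ⧸ Ideal.span {π}) ⧸ (Ideal.map (Ideal.Quotient.mk (Ideal.span {π})) m)) →ₗ[R] N) →ₗ[R] N := LinearMap.applyₗ 1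
  have : Module.Finite R (((R ⧸ Ideal.span {π}) ⧸ (Ideal.map (Ideal.Quotient.mk (Ideal.span {π})) m)) →ₗ[R] N) :=
    Module.Finite.equiv ((Abelian.Ext.linearEquiv₀ (R := R) (X := ModuleCat.of R ((R ⧸ Ideal.span {π}) ⧸ (Ideal.map (Ideal.Quotient.mk (Ideal.span {π})) m)))
      (Y := ModuleCat.of R N)).trans ModuleCat.homLinearEquiv)
  have hrange : ∀ φ, ev φ ∈ LinearMap.range ev1 := by
    intro φ
    have hann : ∀ a ∈ m, a • ev φ = 0 := by
      intro a ha
      have : a • (⟨π, hm⟩ : m) = π • ⟨a, ha⟩ := by ext; simp [mul_comm]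
      change a • φ ⟨π, hm⟩ = 0
      rw [← map_smul, this, map_smul]
      exact aux_pi_smul (B := (R ⧸ Ideal.span {π})) aux_hB _
    have hle : (Ideal.map (Ideal.Quotient.mk (Ideal.span {π})) m) ≤ LinearMap.ker (LinearMap.toSpanSingleton (R ⧸ Ideal.span {π}) N (ev φ)) := by
      intro b hb
      obtain ⟨x, hx, rfl⟩ := (Ideal.mem_map_iff_of_surjective _ Ideal.Quotient.mk_surjective).1 hb
      rw [LinearMap.mem_ker, LinearMap.toSpanSingleton_apply, ← Ideal.Quotient.algebraMap_eq,
        algebraMap_smul, hann x hx]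
    refine ⟨(Submodule.liftQ (Ideal.map (Ideal.Quotient.mk (Ideal.span {π})) m) (LinearMap.toSpanSingleton (R ⧸ Ideal.span {π}) N (ev φ)) hle).restrictScalars R, ?_⟩
    exact (Submodule.liftQ_apply (Ideal.map (Ideal.Quotient.mk (Ideal.span {π})) m) (LinearMap.toSpanSingleton (R ⧸ Ideal.span {π}) N (ev φ)) (h := hle) 1).trans (one_smul _ _)
  have hQ : Module.Finite R (Abelian.Ext (ModuleCat.of R ((R ⧸ Ideal.span {π}) ⧸ (Ideal.map (Ideal.Quotient.mk (Ideal.span {π})) m))) (ModuleCat.of R N) 1 ⧸ E0) := by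
    refine aux_finite_transfer (RingHom.id R) Function.surjective_id (E0.mkQ ∘ₗ δ)
      (E0.mkQ_surjective.comp (hδs inferInstance)) (ev.codRestrict (LinearMap.range ev1) hrange) ?_
    intro φ h
    have : φ ∈ W0 := congr(($h).1)
    change E0.mkQ (δ φ) = 0
    rw [← LinearMap.mem_ker, Submodule.ker_mkQ]
    exact ⟨⟨φ, this⟩, rfl⟩
  exact Module.Finite.of_submodule_quotient E0

include hm hnzd in
theorem aux_K_two (n : ℕ) (hn : n ≠ 0)
    (h0 : Module.Finite (R ⧸ Ideal.span {π}) (Abelian.Ext (ModuleCat.of (R ⧸ Ideal.span {π}) ((R ⧸ Ideal.span {π}) ⧸ (Ideal.map (Ideal.Quotient.mk (Ideal.span {π})) m))) (ModuleCat.of (R ⧸ Ideal.span {π}) N) n))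
    (h : Module.Finite (R ⧸ Ideal.span {π}) (Abelian.Ext (ModuleCat.of (R ⧸ Ideal.span {π}) ((R ⧸ Ideal.span {π}) ⧸ (Ideal.map (Ideal.Quotient.mk (Ideal.span {π})) m))) (ModuleCat.of (R ⧸ Ideal.span {π}) N) (n+1))) :
    Module.Finite R (Abelian.Ext (ModuleCat.of R ((R ⧸ Ideal.span {π}) ⧸ (Ideal.map (Ideal.Quotient.mk (Ideal.span {π})) m))) (ModuleCat.of R N) (n+1)) := by
  obtain ⟨δ, hδs, -⟩ := aux_delta (Submodule.subtype_injective m) (auxG_surj (π := π) m)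
    (auxG_exact m hm) N n
  obtain ⟨δb, -, hδb⟩ := aux_delta (Submodule.subtype_injective (Ideal.map (Ideal.Quotient.mk (Ideal.span {π})) m)) (Submodule.mkQ_surjective (Ideal.map (Ideal.Quotient.mk (Ideal.span {π})) m))
    (auxGb_exact m) N n
  have : IsNoetherian (R ⧸ Ideal.span {π}) (Abelian.Ext (ModuleCat.of (R ⧸ Ideal.span {π}) ((R ⧸ Ideal.span {π}) ⧸ (Ideal.map (Ideal.Quotient.mk (Ideal.span {π})) m))) (ModuleCat.of (R ⧸ Ideal.span {π}) N) (n+1)) :=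
    inferInstance
  have hmm : Module.Finite (R ⧸ Ideal.span {π}) (Abelian.Ext (ModuleCat.of (R ⧸ Ideal.span {π}) (Ideal.map (Ideal.Quotient.mk (Ideal.span {π})) m)) (ModuleCat.of (R ⧸ Ideal.span {π}) N) n) :=
    Module.Finite.of_injective δb (hδb hn)
  let Q := m ⧸ (π • (⊤ : Submodule R m))
  have hsm : ∀ (r : R) (x : m), (algebraMap R (R ⧸ Ideal.span {π}) r) • (Submodule.Quotient.mk x : Q) =
    Submodule.Quotient.mk (r • x) := fun r x => rfl
  let p : m →ₛₗ[algebraMap R (R ⧸ Ideal.span {π})] Q :=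
    { toFun := fun x => Submodule.Quotient.mk x
      map_add' := fun _ _ => rfl
      map_smul' := fun _ _ => rfl }
  have hp : Function.Surjective p := Submodule.Quotient.mk_surjective _
  have hpk : ∀ x, p x = 0 ↔ ∃ y, x = π • y := by
    intro x
    change (Submodule.Quotient.mk x : Q) = 0 ↔ _
    rw [Submodule.Quotient.mk_eq_zero, Submodule.mem_smul_pointwise_iff_exists]
    simp [eq_comm]
  -- the map Q → m̄
  have hPk : ∀ x, p x = 0 → auxP (π := π) m x = 0 := by
    intro x hx
    obtain ⟨y, rfl⟩ := (hpk x).1 hx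
    rw [map_smulₛₗ, (aux_hB π).2 ⟨1, by simp⟩, zero_smul]
  choose s hs using hp
  have key : ∀ x, auxP (π := π) m (s (p x)) = auxP m x := by
    intro x
    rw [← sub_eq_zero, ← map_sub]
    exact hPk _ (by rw [map_sub, hs, sub_self])
  have hs2 : ∀ b, ∃ x, b = p x := fun b => ⟨s b, (hs b).symm⟩
  let g : Q →ₗ[(R ⧸ Ideal.span {π})] (Ideal.map (Ideal.Quotient.mk (Ideal.span {π})) m) :=
    { toFun := fun b => auxP m (s b)
      map_add' := by
        intro x y
        obtain ⟨x, rfl⟩ := hs2 x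
        obtain ⟨y, rfl⟩ := hs2 y
        rw [← map_add, key, key, key, map_add]
      map_smul' := by
        intro b y
        obtain ⟨b, rfl⟩ := aux_hsurj b
        obtain ⟨y, rfl⟩ := hs2 y
        rw [← map_smulₛₗ, key, key, map_smulₛₗ, RingHom.id_apply] }
  have hgp : ∀ x, g (p x) = auxP m x := key
  have hg : Function.Surjective g := by
    intro b
    obtain ⟨x, rfl⟩ := auxP_surj m b
    exact ⟨p x, hgp x⟩
  let f0 : (R ⧸ Ideal.span {π}) →ₗ[(R ⧸ Ideal.span {π})] Q := LinearMap.toSpanSingleton (R ⧸ Ideal.span {π}) Q (p ⟨π, hm⟩)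
  have hf0 : ∀ r : R, f0 (algebraMap R (R ⧸ Ideal.span {π}) r) = p (r • ⟨π, hm⟩) := fun r => by
    rw [LinearMap.toSpanSingleton_apply, map_smulₛₗ]
  have hker : ∀ r : R, f0 (algebraMap R (R ⧸ Ideal.span {π}) r) = 0 ↔ r ∈ m := by
    intro r
    rw [hf0, hpk]
    constructor
    · rintro ⟨y, hy⟩
      have h1 : r * π = π * y.1 := congr(($hy).1)
      have : r = y.1 := by
        rw [← sub_eq_zero]; apply hnzd; rw [mul_sub, ← h1]; ring
      rw [this]; exact y.2
    · intro hr
      exact ⟨⟨r, hr⟩, by ext; simp [mul_comm]⟩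
  have hle : (Ideal.map (Ideal.Quotient.mk (Ideal.span {π})) m) ≤ LinearMap.ker f0 := by
    intro b hb
    obtain ⟨x, hx, rfl⟩ := (Ideal.mem_map_iff_of_surjective _ Ideal.Quotient.mk_surjective).1 hb
    exact (hker x).2 hx
  let i : ((R ⧸ Ideal.span {π}) ⧸ (Ideal.map (Ideal.Quotient.mk (Ideal.span {π})) m)) →ₗ[(R ⧸ Ideal.span {π})] Q := Submodule.liftQ (Ideal.map (Ideal.Quotient.mk (Ideal.span {π})) m) f0 hle
  have hiG : ∀ r : R, i (auxG m r) = f0 (algebraMap R (R ⧸ Ideal.span {π}) r) := fun r => rfl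
  have hi : Function.Injective i := by
    rw [injective_iff_map_eq_zero]
    intro x hx
    obtain ⟨r, rfl⟩ := auxG_surj m x
    rw [hiG, hker] at hx
    exact (auxG_exact m hm r).2 ⟨⟨r, hx⟩, rfl⟩
  have hex : Function.Exact i g := by
    intro x
    obtain ⟨x, rfl⟩ := hs2 x
    rw [hgp]
    constructor
    · intro h
      obtain ⟨t, ht⟩ := (aux_hB (π := π) x.1).1 congr(($h).1)
      refine ⟨auxG m t, ?_⟩
      rw [hiG, hf0]
      congr 1
      ext
      rw [ht]; simp [mul_comm]
    · rintro ⟨y, hy⟩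
      obtain ⟨r, rfl⟩ := auxG_surj m y
      rw [hiG, hf0] at hy
      rw [← hgp, ← hy, hgp, map_smulₛₗ]
      have : auxP (π := π) m ⟨π, hm⟩ = 0 := by
        ext1; exact (aux_hB π).2 ⟨1, by simp⟩
      rw [this, smul_zero]
  have hQ := aux_mid hi hg hex N n hmm h0
  have := aux_claimA (N := N) (X := m) (Xb := Q) aux_hsurj aux_hB n p
    (Submodule.Quotient.mk_surjective _) (fun x => (hpk x).1)
    (fun x hx => by ext; exact hnzd _ congr(($hx).1)) hnzd hQ
  exact Module.Finite.of_surjective δ hδs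

include hm hnzd in
theorem aux_K
    (h : ∀ n, Module.Finite (R ⧸ Ideal.span {π}) (Abelian.Ext (ModuleCat.of (R ⧸ Ideal.span {π}) ((R ⧸ Ideal.span {π}) ⧸ (Ideal.map (Ideal.Quotient.mk (Ideal.span {π})) m))) (ModuleCat.of (R ⧸ Ideal.span {π}) N) n))
    (n : ℕ) :
    Module.Finite R (Abelian.Ext (ModuleCat.of R ((R ⧸ Ideal.span {π}) ⧸ (Ideal.map (Ideal.Quotient.mk (Ideal.span {π})) m))) (ModuleCat.of R N) n) := by
  match n with
  | 0 => exact aux_K_zero m N (h 0)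
  | 1 => exact aux_K_one m hm N (aux_K_zero m N (h 0)) (h 1)
  | n + 2 => exact aux_K_two m hm hnzd N (n+1) (by simp) (h _) (h _)

end main


theorem aux_main {R : Type u} [CommRing R] [IsNoetherianRing R] {π : R} (Z : ModuleCat.{u} R)
    (hZ : ∀ z : Z, π • z = 0)
    {M : Type u} [AddCommGroup M] [Module R M]
    (h1 : ∀ j, Module.Finite R (Abelian.Ext Z (ModuleCat.of R (Submodule.torsionBy R M π)) j))
    (h2 : ∀ j, Module.Finite R (Abelian.Ext Z (ModuleCat.of R (M ⧸ π • (⊤ : Submodule R M))) j))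
    (j : ℕ) : Module.Finite R (Abelian.Ext Z (ModuleCat.of R M) j) := by
  let P : Submodule R M := π • ⊤
  let q : M →ₗ[R] P := (LinearMap.lsmul R M π).codRestrict P
    (fun x => Submodule.smul_mem_pointwise_smul x π ⊤ trivial)
  have hq : Function.Surjective q := by
    rintro ⟨x, hx⟩
    obtain ⟨y, -, rfl⟩ := (Submodule.mem_smul_pointwise_iff_exists _ _ _).1 hx
    exact ⟨y, rfl⟩
  have hqex : Function.Exact (Submodule.torsionBy R M π).subtype q := by
    intro x
    constructor
    · intro h
      exact ⟨⟨x, congr(($h).1)⟩, rfl⟩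
    · rintro ⟨x, rfl⟩
      ext1; exact x.2
  have hPex : Function.Exact P.subtype P.mkQ := by
    intro x; simp
  let a := (Abelian.Ext.mk₀ (ModuleCat.ofHom (Submodule.torsionBy R M π).subtype)).postcompOfLinear R Z (add_zero j)
  let f := (Abelian.Ext.mk₀ (ModuleCat.ofHom q)).postcompOfLinear R Z (add_zero j)
  let g := (Abelian.Ext.mk₀ (ModuleCat.ofHom P.subtype)).postcompOfLinear R Z (add_zero j)
  have hgf : ∀ x, g (f x) = 0 := by
    intro x
    change (x.comp (Abelian.Ext.mk₀ (ModuleCat.ofHom q)) (add_zero j)).comp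
      (Abelian.Ext.mk₀ (ModuleCat.ofHom P.subtype)) (add_zero j) = 0
    rw [Abelian.Ext.comp_assoc_of_third_deg_zero, Abelian.Ext.mk₀_comp_mk₀]
    have e1 : ModuleCat.ofHom q ≫ ModuleCat.ofHom P.subtype = π • 𝟙 (ModuleCat.of R M) := by
      ext x; rfl
    have e2 : π • 𝟙 Z = 0 := by
      ext x; exact hZ x
    rw [e1, Abelian.Ext.mk₀_smul, Abelian.Ext.comp_smul, Abelian.Ext.comp_mk₀_id,
      ← Abelian.Ext.mk₀_id_comp x, ← Abelian.Ext.smul_comp, ← Abelian.Ext.mk₀_smul, e2]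
    simp
  have hker : Module.Finite R (LinearMap.ker g) := by
    rcases j with _ | j
    · have hinj : Function.Injective g := by
        have : Mono (ModuleCat.ofHom P.subtype) :=
          (ModuleCat.mono_iff_injective _).2 P.subtype_injective
        exact Abelian.Ext.postcomp_mk₀_injective_of_mono Z (ModuleCat.ofHom P.subtype)
      rw [LinearMap.ker_eq_bot.2 hinj]
      infer_instance
    · obtain ⟨δ, hδ⟩ := aux_cov_left P.subtype_injective P.mkQ_surjective hPex Z j
      have hle : LinearMap.ker g ≤ LinearMap.range δ := fun x hx => hδ x hx
      have := h2 j
      exact Module.Finite.of_injective (Submodule.inclusion hle) (Submodule.inclusion_injective hle)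
  have := h1 j
  have : IsNoetherian R (LinearMap.ker g) := inferInstance
  let f' := f.codRestrict (LinearMap.ker g) hgf
  have hex : LinearMap.range a = LinearMap.ker f' := by
    have hf' : LinearMap.ker f' = LinearMap.ker f := LinearMap.ker_codRestrict _ _ _
    rw [hf']
    apply le_antisymm
    · rintro _ ⟨x, rfl⟩
      change (x.comp (Abelian.Ext.mk₀ (ModuleCat.ofHom (Submodule.torsionBy R M π).subtype)) (add_zero j)).comp
        (Abelian.Ext.mk₀ (ModuleCat.ofHom q)) (add_zero j) = 0
      rw [Abelian.Ext.comp_assoc_of_third_deg_zero, Abelian.Ext.mk₀_comp_mk₀]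
      have : ModuleCat.ofHom (Submodule.torsionBy R M π).subtype ≫ ModuleCat.ofHom q = 0 := by
        ext1; exact hqex.linearMap_comp_eq_zero
      rw [this]; simp
    · intro x hx
      exact aux_cov_mid (Submodule.subtype_injective _) hq hqex Z j x hx
  have := isNoetherian_of_range_eq_ker a f' hex
  infer_instance

theorem aux_final
    (R : Type u) [CommRing R] [IsLocalRing R] [IsNoetherianRing R]
    (π : R) (hπm : π ∈ maximalIdeal R) (hπ : π ∈ nonZeroDivisors R)
    (M : Type u) [AddCommGroup M] [Module R M]
    (h1 : ∀ j : ℕ, Module.Finite (R ⧸ Ideal.span {π})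
        (((Ext (R ⧸ Ideal.span {π}) (ModuleCat.{u} (R ⧸ Ideal.span {π})) j).obj
          (Opposite.op (ModuleCat.of _ ((R ⧸ Ideal.span {π}) ⧸
            (maximalIdeal R).map (Ideal.Quotient.mk (Ideal.span {π})))))).obj
          (ModuleCat.of _ (Submodule.torsionBy R M π))))
    (h2 : ∀ j : ℕ, Module.Finite (R ⧸ Ideal.span {π})
        (((Ext (R ⧸ Ideal.span {π}) (ModuleCat.{u} (R ⧸ Ideal.span {π})) j).obj
          (Opposite.op (ModuleCat.of _ ((R ⧸ Ideal.span {π}) ⧸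
            (maximalIdeal R).map (Ideal.Quotient.mk (Ideal.span {π})))))).obj
          (ModuleCat.of _ (M ⧸ π • (⊤ : Submodule R M))))) :
    ∀ j : ℕ, Module.Finite R
      (((Ext R (ModuleCat.{u} R) j).obj
        (Opposite.op (ModuleCat.of R (ResidueField R)))).obj (ModuleCat.of R M)) := by
  intro j
  have hnzd : ∀ r : R, π * r = 0 → r = 0 := fun r hr =>
    (mul_left_mem_nonZeroDivisors_eq_zero_iff hπ).1 hr
  have t1 : IsScalarTower R (R ⧸ Ideal.span {π}) (Submodule.torsionBy R M π) :=
    ⟨fun r b x => by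
      obtain ⟨b, rfl⟩ := Ideal.Quotient.mk_surjective b
      exact mul_smul r b x⟩
  have t2 : IsScalarTower R (R ⧸ Ideal.span {π}) (M ⧸ π • (⊤ : Submodule R M)) :=
    ⟨fun r b x => by
      obtain ⟨b, rfl⟩ := Ideal.Quotient.mk_surjective b
      exact mul_smul r b x⟩
  have k1 := aux_K (maximalIdeal R) hπm hnzd (Submodule.torsionBy R M π) (fun n => by
    have := h1 n
    exact Module.Finite.equiv (aux_compare _ _ n).some)
  have k2 := aux_K (maximalIdeal R) hπm hnzd (M ⧸ π • (⊤ : Submodule R M)) (fun n => by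
    have := h2 n
    exact Module.Finite.equiv (aux_compare _ _ n).some)
  have k3 := aux_main _ (fun z => aux_pi_smul (B := R ⧸ Ideal.span {π}) aux_hB z) k1 k2 j
  have e : ResidueField R ≃ₗ[R] ((R ⧸ Ideal.span {π}) ⧸
      (maximalIdeal R).map (Ideal.Quotient.mk (Ideal.span {π}))) :=
    (Submodule.quotEquivOfEq (maximalIdeal R) _
      (by
        have := LinearMap.exact_iff.1 (auxG_exact (maximalIdeal R) hπm)
        rw [this, Submodule.range_subtype])).trans
      ((auxG (π := π) (maximalIdeal R)).quotKerEquivOfSurjective (auxG_surj _))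
  let i := e.toModuleIso
  let F := (Abelian.Ext.mk₀ i.hom).precompOfLinear R (ModuleCat.of R M) (zero_add j)
  have hF : Function.Surjective F := by
    intro x
    refine ⟨(Abelian.Ext.mk₀ i.inv).comp x (zero_add j), ?_⟩
    change (Abelian.Ext.mk₀ i.hom).comp ((Abelian.Ext.mk₀ i.inv).comp x (zero_add j)) (zero_add j) = x
    rw [Abelian.Ext.mk₀_comp_mk₀_assoc, i.hom_inv_id, Abelian.Ext.mk₀_id_comp]
  have := Module.Finite.of_surjective F hF
  exact Module.Finite.equiv (aux_compare (ModuleCat.of R (ResidueField R)) (ModuleCat.of R M) j).some.symm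

theorem finite_bass_numbers_of_finite_bass_numbers_ann_and_quotient
    (R : Type u) [CommRing R] [IsLocalRing R] [IsNoetherianRing R]
    (hCM : IsCohenMacaulayLocalRing R)
    (π : R) (hπm : π ∈ maximalIdeal R) (hπ : π ∈ nonZeroDivisors R)
    (M : Type u) [AddCommGroup M] [Module R M]
    (h1 : ∀ j : ℕ, Module.Finite (R ⧸ Ideal.span {π})
        (((Ext (R ⧸ Ideal.span {π}) (ModuleCat.{u} (R ⧸ Ideal.span {π})) j).obj
          (Opposite.op (ModuleCat.of _ ((R ⧸ Ideal.span {π}) ⧸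
            (maximalIdeal R).map (Ideal.Quotient.mk (Ideal.span {π})))))).obj
          (ModuleCat.of _ (Submodule.torsionBy R M π))))
    (h2 : ∀ j : ℕ, Module.Finite (R ⧸ Ideal.span {π})
        (((Ext (R ⧸ Ideal.span {π}) (ModuleCat.{u} (R ⧸ Ideal.span {π})) j).obj
          (Opposite.op (ModuleCat.of _ ((R ⧸ Ideal.span {π}) ⧸
            (maximalIdeal R).map (Ideal.Quotient.mk (Ideal.span {π})))))).obj
          (ModuleCat.of _ (M ⧸ π • (⊤ : Submodule R M))))) :
    ∀ j : ℕ, Module.Finite R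
      (((Ext R (ModuleCat.{u} R) j).obj
        (Opposite.op (ModuleCat.of R (ResidueField R)))).obj (ModuleCat.of R M)) := by
  exact aux_final R π hπm hπ M h1 h2
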